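/- arXiv:2307.10906 — 2 statements merged into one kernel-verified Lean document; each statement's English description precedes it below -/
import Mathlib

section
/- Let n ≥ 5, Ω ⊆ ℝⁿ an open set, V : (0,∞) → [0,∞) and H : (0,∞) → ℝ smooth functions such that −H'(t) + H(t)·(n−1)/t − H(t)² ≥ V(t) for all t > 0. If E₁(t) = H'(t) + H(t)·(n−3)/t ≥ 0 for all t > 0, then for every u ∈ C_0^∞(Ω) one has ∫_Ω |Δu|² dx ≥ ∫_Ω V(|x|)·|∇^{rad}u(x)|² dx. -/
open MeasureTheory Real Set Filter
open scoped RealInnerProductSpace ENNReal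

noncomputable section

/-- Euclidean `n`-space. -/
abbrev E (n : ℕ) := EuclideanSpace ℝ (Fin n)

/-- The Euclidean Laplacian of `u : E n → ℝ`. -/
def eLap {n : ℕ} (u : E n → ℝ) (x : E n) : ℝ :=
  ∑ i : Fin n, fderiv ℝ (fun y => fderiv ℝ u y (EuclideanSpace.single i 1)) x
    (EuclideanSpace.single i 1)

/-- The radial derivative of `u` at `x` with respect to the base point `x₀`:
`⟨∇u(x), (x - x₀)/‖x - x₀‖⟩`. -/
def radDeriv {n : ℕ} (x₀ : E n) (u : E n → ℝ) (x : E n) : ℝ :=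
  ⟪gradient u x, x - x₀⟫ / ‖x - x₀‖

/-- The `i`-th partial derivative of `u`. -/
def partialDeriv {n : ℕ} (u : E n → ℝ) (i : Fin n) (x : E n) : ℝ :=
  fderiv ℝ u x (EuclideanSpace.single i 1)

/-- The squared length of the gradient of `u`. -/
def gradSq {n : ℕ} (u : E n → ℝ) (x : E n) : ℝ :=
  ∑ i, partialDeriv u i x ^ 2

/-- The derivative of `u` at `x` in the direction `x`. -/
def eulerDeriv {n : ℕ} (u : E n → ℝ) (x : E n) : ℝ :=
  ∑ i, x i * partialDeriv u i x

section Calculus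

variable {n : ℕ} {u : E n → ℝ}

lemma eulerDeriv_eq_fderiv (u : E n → ℝ) (x : E n) : eulerDeriv u x = fderiv ℝ u x x := by
  have hx : x = ∑ i, x i • (EuclideanSpace.single i 1 : E n) := by
    ext j
    simp [Finset.sum_apply, Pi.single_apply]
  have h := congrArg (fderiv ℝ u x) hx
  rw [h, map_sum]
  simp [eulerDeriv, partialDeriv]

lemma radDeriv_zero_eq (u : E n → ℝ) (x : E n) : radDeriv 0 u x = eulerDeriv u x / ‖x‖ := by
  rw [radDeriv, sub_zero, eulerDeriv_eq_fderiv, inner_gradient_left]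

lemma eulerDeriv_sq_le (u : E n → ℝ) (x : E n) :
    eulerDeriv u x ^ 2 ≤ ‖x‖ ^ 2 * gradSq u x := by
  rw [EuclideanSpace.real_norm_sq_eq]
  exact Finset.sum_mul_sq_le_sq_mul_sq _ _ _

lemma contDiff_partialDeriv (hu : ContDiff ℝ (⊤ : ℕ∞) u) (i : Fin n) :
    ContDiff ℝ (⊤ : ℕ∞) (partialDeriv u i) :=
  (hu.fderiv_right (m := (⊤ : ℕ∞)) (by simp)).clm_apply contDiff_const

lemma contDiff_gradSq (hu : ContDiff ℝ (⊤ : ℕ∞) u) : ContDiff ℝ (⊤ : ℕ∞) (gradSq u) :=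
  ContDiff.sum fun i _ => (contDiff_partialDeriv hu i).pow 2

lemma contDiff_eulerDeriv (hu : ContDiff ℝ (⊤ : ℕ∞) u) : ContDiff ℝ (⊤ : ℕ∞) (eulerDeriv u) :=
  ContDiff.sum fun i _ => (contDiff_piLp_apply (p := 2)).mul (contDiff_partialDeriv hu i)

lemma continuous_eLap (hu : ContDiff ℝ (⊤ : ℕ∞) u) : Continuous (eLap u) :=
  continuous_finsetSum _ fun i _ =>
    (((contDiff_partialDeriv hu i).continuous_fderiv (by simp)).clm_apply continuous_const)

lemma partialDeriv_of_notMem_tsupport {x : E n} (hx : x ∉ tsupport u) (i : Fin n) :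
    partialDeriv u i x = 0 := by
  simp [partialDeriv, fderiv_of_notMem_tsupport ℝ hx]

lemma gradSq_of_notMem_tsupport {x : E n} (hx : x ∉ tsupport u) : gradSq u x = 0 := by
  simp [gradSq, partialDeriv_of_notMem_tsupport hx]

lemma eulerDeriv_of_notMem_tsupport {x : E n} (hx : x ∉ tsupport u) : eulerDeriv u x = 0 := by
  simp [eulerDeriv, partialDeriv_of_notMem_tsupport hx]

lemma eLap_of_notMem_tsupport {x : E n} (hx : x ∉ tsupport u) : eLap u x = 0 := by
  refine Finset.sum_eq_zero fun i _ => ?_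
  have h : (fun y => fderiv ℝ u y (EuclideanSpace.single i 1)) =ᶠ[nhds x] fun _ => 0 := by
    filter_upwards [(isClosed_tsupport u).isOpen_compl.mem_nhds hx] with y hy
    exact partialDeriv_of_notMem_tsupport hy i
  simp [h.fderiv_eq]

lemma fderiv_partialDeriv_comm (hu : ContDiff ℝ (⊤ : ℕ∞) u) (i j : Fin n) (x : E n) :
    fderiv ℝ (partialDeriv u i) x (EuclideanSpace.single j 1) =
      fderiv ℝ (partialDeriv u j) x (EuclideanSpace.single i 1) := by
  have hd : DifferentiableAt ℝ (fderiv ℝ u) x :=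
    ((hu.fderiv_right (m := (⊤ : ℕ∞)) (by simp)).differentiable (by simp)) x
  have h (k : Fin n) (w : E n) : fderiv ℝ (partialDeriv u k) x w =
      fderiv ℝ (fderiv ℝ u) x w (EuclideanSpace.single k 1) := by
    unfold partialDeriv
    rw [fderiv_clm_apply hd (differentiableAt_const _)]
    simp
  rw [h, h]
  exact (hu.contDiffAt.isSymmSndFDerivAt
    (by simpa using WithTop.coe_le_coe.2 (le_top : (2 : ℕ∞) ≤ ⊤))).eq _ _

lemma integral_fderiv_apply_eq_zero {f : E n → ℝ} (hf : ContDiff ℝ 1 f)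
    (hc : HasCompactSupport f) (v : E n) : ∫ x, fderiv ℝ f x v = 0 := by
  have hi : Integrable f := hf.continuous.integrable_of_hasCompactSupport hc
  have hi' : Integrable (fun x => fderiv ℝ f x v) :=
    ((hf.continuous_fderiv (by simp)).clm_apply
      continuous_const).integrable_of_hasCompactSupport (hc.fderiv_apply ℝ v)
  have := integral_mul_fderiv_eq_neg_fderiv_mul_of_integrable (μ := volume) (𝕜 := ℝ)
    (f := fun _ : E n => (1 : ℝ)) (g := f) (v := v) (by simp) (by simpa using hi')
    (by simpa using hi) (fun x _ => differentiableAt_const _)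
    (fun x _ => hf.differentiable (by simp) x)
  simpa using this

/-- The integrand of the Pohozaev identity for the radial vector field `a(x) x`, where
`∇a(x) = c(x) x`. -/
def pohozaevIntegrand (u a c : E n → ℝ) (x : E n) : ℝ :=
  2 * c x * eulerDeriv u x ^ 2 + 2 * a x * eulerDeriv u x * eLap u x
    - (c x * ‖x‖ ^ 2 + (n - 2) * a x) * gradSq u x

/-- The components of the vector field whose divergence is `pohozaevIntegrand u a c`. -/
def pohozaevField (u a : E n → ℝ) (i : Fin n) (x : E n) : ℝ :=
  2 * (a x * (eulerDeriv u x * partialDeriv u i x)) - a x * (gradSq u x * x i)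

lemma fderiv_eulerDeriv (hu : ContDiff ℝ (⊤ : ℕ∞) u) (i : Fin n) (x : E n) :
    fderiv ℝ (eulerDeriv u) x (EuclideanSpace.single i 1) = partialDeriv u i x +
      ∑ j, x j * fderiv ℝ (partialDeriv u j) x (EuclideanSpace.single i 1) := by
  have h := HasFDerivAt.fun_sum (u := Finset.univ) fun j _ =>
    (EuclideanSpace.proj (𝕜 := ℝ) j : E n →L[ℝ] ℝ).hasFDerivAt (x := x) |>.mul
      ((contDiff_partialDeriv hu j).differentiable (by simp) x).hasFDerivAt
  have h' : HasFDerivAt (eulerDeriv u) _ x := h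
  rw [h'.fderiv]
  simp [Finset.sum_add_distrib, add_comm]

lemma fderiv_gradSq (hu : ContDiff ℝ (⊤ : ℕ∞) u) (i : Fin n) (x : E n) :
    fderiv ℝ (gradSq u) x (EuclideanSpace.single i 1) =
      2 * ∑ j, partialDeriv u j x *
        fderiv ℝ (partialDeriv u j) x (EuclideanSpace.single i 1) := by
  have h := HasFDerivAt.fun_sum (u := Finset.univ) fun j _ =>
      ((contDiff_partialDeriv hu j).differentiable (by simp) x).hasFDerivAt.pow 2
  have h' : HasFDerivAt (gradSq u) _ x := h
  rw [h'.fderiv]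
  simp [Finset.mul_sum, mul_assoc]

lemma fderiv_pohozaevField (hu : ContDiff ℝ (⊤ : ℕ∞) u) {a c : E n → ℝ} {x : E n}
    (ha : HasFDerivAt a (c x • innerSL ℝ x) x) (i : Fin n) :
    fderiv ℝ (pohozaevField u a i) x (EuclideanSpace.single i 1) =
      2 * c x * eulerDeriv u x * (x i * partialDeriv u i x)
      + 2 * a x * partialDeriv u i x ^ 2
      + 2 * a x * (partialDeriv u i x *
          ∑ j, x j * fderiv ℝ (partialDeriv u j) x (EuclideanSpace.single i 1))
      + 2 * a x * eulerDeriv u x *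
          fderiv ℝ (partialDeriv u i) x (EuclideanSpace.single i 1)
      - c x * gradSq u x * x i ^ 2 - a x * gradSq u x
      - 2 * a x * (x i * ∑ j, partialDeriv u j x *
          fderiv ℝ (partialDeriv u j) x (EuclideanSpace.single i 1)) := by
  have hS := ((contDiff_eulerDeriv hu).differentiable (by simp) x).hasFDerivAt
  have hN := ((contDiff_gradSq hu).differentiable (by simp) x).hasFDerivAt
  have hb := ((contDiff_partialDeriv hu i).differentiable (by simp) x).hasFDerivAt
  have hx := (EuclideanSpace.proj (𝕜 := ℝ) i : E n →L[ℝ] ℝ).hasFDerivAt (x := x)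
  have h : HasFDerivAt (pohozaevField u a i) _ x :=
    ((ha.mul (hS.mul hb)).const_mul 2).sub (ha.mul (hN.mul hx))
  rw [h.fderiv]
  have hin : innerSL ℝ x (EuclideanSpace.single i (1 : ℝ)) = x i := by
    simpa using EuclideanSpace.inner_single_right (𝕜 := ℝ) i 1 x
  simp [fderiv_eulerDeriv hu, fderiv_gradSq hu, hin]
  ring

lemma sum_fderiv_pohozaevField (hu : ContDiff ℝ (⊤ : ℕ∞) u) {a c : E n → ℝ} {x : E n}
    (ha : HasFDerivAt a (c x • innerSL ℝ x) x) :
    ∑ i, fderiv ℝ (pohozaevField u a i) x (EuclideanSpace.single i 1) =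
      pohozaevIntegrand u a c x := by
  have hcomm : ∑ i, partialDeriv u i x *
        ∑ j, x j * fderiv ℝ (partialDeriv u j) x (EuclideanSpace.single i 1) =
      ∑ i, x i * ∑ j, partialDeriv u j x *
        fderiv ℝ (partialDeriv u j) x (EuclideanSpace.single i 1) := by
    simp_rw [Finset.mul_sum]
    rw [Finset.sum_comm]
    refine Finset.sum_congr rfl fun i _ => Finset.sum_congr rfl fun j _ => ?_
    rw [fderiv_partialDeriv_comm hu i j]
    ring
  simp_rw [fderiv_pohozaevField hu ha, Finset.sum_sub_distrib, Finset.sum_add_distrib,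
    ← Finset.mul_sum, hcomm]
  have hL : ∑ i, fderiv ℝ (partialDeriv u i) x (EuclideanSpace.single i 1) = eLap u x := rfl
  rw [hL, ← EuclideanSpace.real_norm_sq_eq, ← eulerDeriv, ← gradSq, pohozaevIntegrand]
  simp
  ring

/-- Pohozaev identity: `pohozaevIntegrand u a c` is the divergence of a compactly supported
field. -/
lemma integral_pohozaevIntegrand (hu : ContDiff ℝ (⊤ : ℕ∞) u) (hcs : HasCompactSupport u)
    {a c : E n → ℝ} (hc : Continuous c) (ha : ∀ x, HasFDerivAt a (c x • innerSL ℝ x) x) :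
    Integrable (pohozaevIntegrand u a c) ∧ ∫ x, pohozaevIntegrand u a c x = 0 := by
  have ha1 : ContDiff ℝ 1 a := by
    refine contDiff_one_iff_hasFDerivAt.2 ⟨_, ?_, ha⟩
    exact hc.smul (innerSL ℝ).continuous
  have hY (i : Fin n) : ContDiff ℝ 1 (pohozaevField u a i) := by
    have h1 := (contDiff_eulerDeriv hu).of_le (m := 1) (by simp)
    have h2 := (contDiff_gradSq hu).of_le (m := 1) (by simp)
    have h3 := (contDiff_partialDeriv hu i).of_le (m := 1) (by simp)
    exact (contDiff_const.mul (ha1.mul (h1.mul h3))).sub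
      (ha1.mul (h2.mul (contDiff_piLp_apply (p := 2))))
  have hYc (i : Fin n) : HasCompactSupport (pohozaevField u a i) :=
    HasCompactSupport.intro hcs fun x hx => by
      simp [pohozaevField, eulerDeriv_of_notMem_tsupport hx, gradSq_of_notMem_tsupport hx]
  have hI (i : Fin n) : Integrable fun x =>
      fderiv ℝ (pohozaevField u a i) x (EuclideanSpace.single i 1) :=
    (((hY i).continuous_fderiv (by simp)).clm_apply
      continuous_const).integrable_of_hasCompactSupport ((hYc i).fderiv_apply ℝ _)
  have heq : pohozaevIntegrand u a c = fun x =>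
      ∑ i, fderiv ℝ (pohozaevField u a i) x (EuclideanSpace.single i 1) :=
    funext fun x => (sum_fderiv_pohozaevField hu (ha x)).symm
  rw [heq]
  refine ⟨integrable_finsetSum _ fun i _ => hI i, ?_⟩
  rw [integral_finsetSum _ fun i _ => hI i]
  exact Finset.sum_eq_zero fun i _ => integral_fderiv_apply_eq_zero (hY i) (hYc i) _

end Calculus

section Radial

variable {n : ℕ} {u : E n → ℝ} {V H φ : ℝ → ℝ}

lemma continuous_comp_norm_of_eq_zero {f : ℝ → ℝ} {δ : ℝ} (hδ : 0 < δ)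
    (hf : ContinuousOn f (Ioi 0)) (h0 : ∀ t < δ, f t = 0) : Continuous fun x : E n => f ‖x‖ := by
  rw [continuous_iff_continuousAt]
  intro x
  rcases lt_or_ge ‖x‖ δ with hx | hx
  · have h : (fun y : E n => f ‖y‖) =ᶠ[nhds x] fun _ => 0 := by
      filter_upwards [(isOpen_lt continuous_norm continuous_const).mem_nhds hx] with y hy
      exact h0 _ hy
    exact continuousAt_const.congr h.symm
  · exact (hf.continuousAt (Ioi_mem_nhds (hδ.trans_le hx))).comp
      (f := fun y : E n => ‖y‖) continuous_norm.continuousAt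

lemma hasFDerivAt_norm {x : E n} (hx : x ≠ 0) :
    HasFDerivAt (fun y : E n => ‖y‖) (‖x‖⁻¹ • innerSL ℝ x) x := by
  have h := (hasStrictFDerivAt_norm_sq x).hasFDerivAt.sqrt (by simpa using hx)
  simp only [Real.sqrt_sq (norm_nonneg _)] at h
  refine h.congr_fderiv ?_
  ext v
  simp
  ring

lemma hasFDerivAt_comp_norm {A C : ℝ → ℝ} {δ : ℝ} (hδ : 0 < δ) (h0 : ∀ t < δ, A t = 0)
    (hA : ∀ t > 0, HasDerivAt A (t * C t) t) (x : E n) :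
    HasFDerivAt (fun y : E n => A ‖y‖) (C ‖x‖ • innerSL ℝ x) x := by
  rcases eq_or_ne x 0 with rfl | hx
  · have h : (fun y : E n => A ‖y‖) =ᶠ[nhds 0] fun _ => 0 := by
      filter_upwards [(isOpen_lt continuous_norm continuous_const).mem_nhds
        (show ‖(0 : E n)‖ < δ by simpa using hδ)] with y hy
      exact h0 _ hy
    simpa using (hasFDerivAt_const (0 : ℝ) (0 : E n)).congr_of_eventuallyEq h
  · have hpos := norm_pos_iff.2 hx
    have h := (hA ‖x‖ hpos).comp_hasFDerivAt x (hasFDerivAt_norm hx)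
    refine h.congr_fderiv ?_
    rw [smul_smul]
    congr 1
    field_simp

/-- The pointwise inequality behind the truncated estimate, where `p`, `N`, `L` stand for the
radial derivative, the squared gradient and the Laplacian, and `s` for the inverse radius. -/
lemma riccati_pointwise {m s φ φ' h h' v p N L : ℝ} (hφ0 : 0 ≤ φ) (hφ1 : φ ≤ 1) (hφ' : 0 ≤ φ')
    (hh : 0 ≤ h) (hRic : v ≤ -h' + h * ((m - 1) * s) - h ^ 2) (hE1 : 0 ≤ h' + h * ((m - 3) * s))
    (hN : p ^ 2 ≤ N) :
    (φ * v - φ' * h) * p ^ 2 + (2 * (φ' * h + φ * h' - φ * h * s) * p ^ 2 + 2 * (φ * h) * p * L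
      - ((φ' * h + φ * h' - φ * h * s) + (m - 2) * (φ * h * s)) * N) ≤ L ^ 2 := by
  have h1 : 0 ≤ (φ * (h' + h * ((m - 3) * s)) + φ' * h) * (N - p ^ 2) :=
    mul_nonneg (add_nonneg (mul_nonneg hφ0 hE1) (mul_nonneg hφ' hh)) (sub_nonneg.2 hN)
  have h2 : 0 ≤ φ * (-h' + h * ((m - 1) * s) - h ^ 2 - v) * p ^ 2 :=
    mul_nonneg (mul_nonneg hφ0 (sub_nonneg.2 hRic)) (sq_nonneg p)
  have h3 : 0 ≤ φ * (1 - φ) * (h * p) ^ 2 :=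
    mul_nonneg (mul_nonneg hφ0 (sub_nonneg.2 hφ1)) (sq_nonneg _)
  have h4 : 0 ≤ (L - φ * h * p) ^ 2 := sq_nonneg _
  linarith

/-- Under the Riccati inequality and the sign condition, `H` and `V` have at most the
homogeneous growth at the origin. -/
lemma riccati_bounds {m t h h' v : ℝ} (ht : 0 < t) (hm : 2 < m) (hv : 0 ≤ v)
    (hRic : -h' + h * ((m - 1) / t) - h ^ 2 ≥ v) (hE1 : h' + h * ((m - 3) / t) ≥ 0) :
    0 ≤ h ∧ h ≤ (2 * m - 4) / t ∧ v ≤ ((2 * m - 4) / t) ^ 2 := by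
  have hc : 0 < (2 * m - 4) / t := div_pos (by linarith) ht
  have hsum : h ^ 2 + v ≤ (2 * m - 4) / t * h := by
    have : h * ((m - 1) / t) + h * ((m - 3) / t) = (2 * m - 4) / t * h := by ring
    linarith
  have h0 : 0 ≤ h := by
    by_contra! hneg
    nlinarith [mul_neg_of_pos_of_neg hc hneg, sq_nonneg h]
  have h1 : h ≤ (2 * m - 4) / t := by
    by_contra! hgt
    nlinarith
  refine ⟨h0, h1, ?_⟩
  nlinarith [sq_nonneg h]

/-- The estimate for a radial weight vanishing near the origin. -/
lemma integral_truncated_le (hn : 5 ≤ n) (hV0 : ∀ t > (0 : ℝ), 0 ≤ V t)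
    (hVc : ContinuousOn V (Ioi 0)) (hHsm : ContDiffOn ℝ (⊤ : ℕ∞) H (Ioi 0))
    (hRic : ∀ t > (0 : ℝ), -(deriv H t) + H t * (((n : ℝ) - 1) / t) - (H t) ^ 2 ≥ V t)
    (hE1 : ∀ t > (0 : ℝ), deriv H t + H t * (((n : ℝ) - 3) / t) ≥ 0)
    (hu : ContDiff ℝ (⊤ : ℕ∞) u) (hcs : HasCompactSupport u)
    (hφ : ContDiff ℝ 1 φ) (hφ0 : ∀ t, 0 ≤ φ t) (hφ1 : ∀ t, φ t ≤ 1) (hφ' : ∀ t, 0 ≤ deriv φ t)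
    {δ : ℝ} (hδ : 0 < δ) (hφδ : ∀ t < δ, φ t = 0) :
    Integrable (fun x => (φ ‖x‖ * V ‖x‖ - deriv φ ‖x‖ * H ‖x‖) / ‖x‖ ^ 2 * eulerDeriv u x ^ 2) ∧
    ∫ x, (φ ‖x‖ * V ‖x‖ - deriv φ ‖x‖ * H ‖x‖) / ‖x‖ ^ 2 * eulerDeriv u x ^ 2 ≤
      ∫ x, eLap u x ^ 2 := by
  have hφ'δ : ∀ t < δ, deriv φ t = 0 := fun t ht => by
    have h : φ =ᶠ[nhds t] fun _ => 0 := by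
      filter_upwards [Iio_mem_nhds ht] with s hs using hφδ s hs
    simp [h.deriv_eq]
  have hHc : ContinuousOn H (Ioi 0) := hHsm.continuousOn
  have hH'c : ContinuousOn (deriv H) (Ioi 0) :=
    hHsm.continuousOn_deriv_of_isOpen isOpen_Ioi (by simp)
  have hφc : ContinuousOn φ (Ioi 0) := hφ.continuous.continuousOn
  have hφ'c : ContinuousOn (deriv φ) (Ioi 0) := (hφ.continuous_deriv le_rfl).continuousOn
  have hid : ContinuousOn (fun t : ℝ => t) (Ioi 0) := continuousOn_id
  have hne : ∀ t ∈ Ioi (0 : ℝ), t ≠ 0 := fun t ht => ne_of_gt ht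
  set A : ℝ → ℝ := fun t => φ t * H t / t with hAdef
  set C : ℝ → ℝ := fun t =>
    (deriv φ t * H t + φ t * deriv H t - φ t * H t / t) / t ^ 2 with hCdef
  have hCc : Continuous fun x : E n => C ‖x‖ := by
    refine continuous_comp_norm_of_eq_zero hδ ?_ fun t ht => by
      simp [hCdef, hφδ t ht, hφ'δ t ht]
    exact (((hφ'c.mul hHc).add (hφc.mul hH'c)).sub ((hφc.mul hHc).div hid hne)).div
      (hid.pow 2) fun t ht => pow_ne_zero 2 (hne t ht)
  have hFc : Continuous fun x : E n =>
      (φ ‖x‖ * V ‖x‖ - deriv φ ‖x‖ * H ‖x‖) / ‖x‖ ^ 2 := by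
    refine continuous_comp_norm_of_eq_zero
      (f := fun t => (φ t * V t - deriv φ t * H t) / t ^ 2) hδ ?_ fun t ht => by
        simp [hφδ t ht, hφ'δ t ht]
    exact ((hφc.mul hVc).sub (hφ'c.mul hHc)).div (hid.pow 2) fun t ht => pow_ne_zero 2 (hne t ht)
  have hA : ∀ t > 0, HasDerivAt A (t * C t) t := fun t ht => by
    have hH := ((hHsm.differentiableOn (by simp)).differentiableAt (Ioi_mem_nhds ht)).hasDerivAt
    have h := (((hφ.differentiable (by simp) t).hasDerivAt.mul hH).div (hasDerivAt_id t) ht.ne')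
    refine h.congr_deriv ?_
    simp only [hCdef, id, Pi.mul_apply]
    field_simp
  have ha := hasFDerivAt_comp_norm (n := n) hδ (fun t ht => by simp [hAdef, hφδ t ht]) hA
  obtain ⟨hGi, hG0⟩ := integral_pohozaevIntegrand hu hcs hCc ha
  have hFi : Integrable fun x : E n =>
      (φ ‖x‖ * V ‖x‖ - deriv φ ‖x‖ * H ‖x‖) / ‖x‖ ^ 2 * eulerDeriv u x ^ 2 :=
    (hFc.mul ((contDiff_eulerDeriv hu).continuous.pow 2)).integrable_of_hasCompactSupport
      (HasCompactSupport.intro hcs fun x hx => by simp [eulerDeriv_of_notMem_tsupport hx])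
  have hLi : Integrable fun x => eLap u x ^ 2 :=
    ((continuous_eLap hu).pow 2).integrable_of_hasCompactSupport
      (HasCompactSupport.intro hcs fun x hx => by simp [eLap_of_notMem_tsupport hx])
  refine ⟨hFi, ?_⟩
  have hle := integral_mono (hFi.add hGi) hLi fun x => ?_
  · rwa [integral_add' hFi hGi, hG0, add_zero] at hle
  · rcases eq_or_ne x 0 with rfl | hx
    · simp [pohozaevIntegrand, eulerDeriv, hAdef, sq_nonneg]
    · have ht := norm_pos_iff.2 hx
      have hN : (eulerDeriv u x / ‖x‖) ^ 2 ≤ gradSq u x := by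
        rw [div_pow, div_le_iff₀ (by positivity), mul_comm]
        exact eulerDeriv_sq_le u x
      have hm : (2 : ℝ) < n := by exact_mod_cast (by omega : 2 < n)
      have h := riccati_pointwise (m := n) (s := ‖x‖⁻¹) (L := eLap u x) (hφ0 ‖x‖) (hφ1 ‖x‖)
        (hφ' ‖x‖)
        (riccati_bounds ht hm (hV0 _ ht) (hRic _ ht) (hE1 _ ht)).1
        (by simpa [div_eq_mul_inv] using hRic _ ht) (by simpa [div_eq_mul_inv] using hE1 _ ht) hN
      refine le_trans (le_of_eq ?_) h
      simp only [Pi.add_apply, pohozaevIntegrand, hAdef, hCdef]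
      field_simp

end Radial

section Cutoff

/-- A smooth cutoff vanishing on `t ≤ 1 / (k + 1)` and equal to one on `t ≥ 2 / (k + 1)`. -/
def originCutoff (k : ℕ) (t : ℝ) : ℝ := smoothTransition ((k + 1) * t - 1)

lemma contDiff_originCutoff (k : ℕ) : ContDiff ℝ 1 (originCutoff k) :=
  (smoothTransition.contDiff (n := 1)).comp ((contDiff_const.mul contDiff_id).sub contDiff_const)

lemma deriv_originCutoff (k : ℕ) (t : ℝ) :
    deriv (originCutoff k) t = (k + 1) * deriv smoothTransition ((k + 1) * t - 1) := by
  have h := ((smoothTransition.contDiff (n := 1)).differentiable (by simp)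
    ((k + 1) * t - 1)).hasDerivAt.comp t (((hasDerivAt_id t).const_mul ((k : ℝ) + 1)).sub_const 1)
  have h' : HasDerivAt (originCutoff k) _ t := h
  rw [h'.deriv]
  simp [mul_comm]

lemma deriv_originCutoff_nonneg (k : ℕ) (t : ℝ) : 0 ≤ deriv (originCutoff k) t := by
  rw [deriv_originCutoff]
  exact mul_nonneg (by positivity) smoothTransition.monotone.deriv_nonneg

lemma exists_deriv_originCutoff_le :
    ∃ M : ℝ, 0 ≤ M ∧ ∀ k t, t * deriv (originCutoff k) t ≤ M := by
  have hc : Continuous fun s : ℝ => (s + 1) * deriv smoothTransition s :=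
    (continuous_id.add continuous_const).mul
      ((smoothTransition.contDiff (n := 1)).continuous_deriv le_rfl)
  obtain ⟨M, hM⟩ := (isCompact_Icc (a := (0 : ℝ)) (b := 1)).bddAbove_image hc.continuousOn
  refine ⟨max M 0, le_max_right _ _, fun k t => ?_⟩
  have h : t * deriv (originCutoff k) t =
      (((k + 1) * t - 1) + 1) * deriv smoothTransition ((k + 1) * t - 1) := by
    rw [deriv_originCutoff]
    ring
  rw [h]
  generalize ((k : ℝ) + 1) * t - 1 = s
  by_cases hs : s ∈ Icc (0 : ℝ) 1
  · exact (hM (mem_image_of_mem _ hs)).trans (le_max_left _ _)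
  · have hz : deriv smoothTransition s = 0 := by
      rcases lt_or_ge s 0 with h0 | h0
      · have h : smoothTransition =ᶠ[nhds s] fun _ => 0 := by
          filter_upwards [Iio_mem_nhds h0] with r hr using smoothTransition.zero_of_nonpos hr.le
        simp [h.deriv_eq]
      · have h1 : 1 < s := by
          by_contra! h1
          exact hs ⟨h0, h1⟩
        have h : smoothTransition =ᶠ[nhds s] fun _ => 1 := by
          filter_upwards [Ioi_mem_nhds h1] with r hr using smoothTransition.one_of_one_le hr.le
        simp [h.deriv_eq]
    simp [hz]

lemma originCutoff_of_lt {k : ℕ} {t : ℝ} (ht : t < 1 / ((k : ℝ) + 1)) : originCutoff k t = 0 := by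
  refine smoothTransition.zero_of_nonpos ?_
  rw [lt_div_iff₀ (by positivity)] at ht
  linarith

lemma eventually_originCutoff {t : ℝ} (ht : 0 < t) :
    ∀ᶠ k in atTop, originCutoff k t = 1 ∧ deriv (originCutoff k) t = 0 := by
  obtain ⟨K, hK⟩ := exists_nat_gt (2 / t)
  filter_upwards [eventually_ge_atTop K] with k hk
  have h2 : 2 / ((k : ℝ) + 1) < t := by
    have : (K : ℝ) ≤ k := by exact_mod_cast hk
    rw [div_lt_iff₀ ht] at hK
    rw [div_lt_iff₀ (by positivity)]
    nlinarith
  have h1 : ∀ r ∈ Ioi (2 / ((k : ℝ) + 1)), originCutoff k r = 1 := fun r hr => by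
    refine smoothTransition.one_of_one_le ?_
    have hr' := (div_lt_iff₀ (by positivity)).1 (mem_Ioi.1 hr)
    linarith
  have h : originCutoff k =ᶠ[nhds t] fun _ => 1 := by
    filter_upwards [Ioi_mem_nhds h2] with r hr using h1 r hr
  exact ⟨h1 t h2, by simp [h.deriv_eq]⟩

end Cutoff

lemma integrable_inv_norm_sq_mul_gradSq {n : ℕ} (hn : 3 ≤ n) {u : E n → ℝ}
    (hu : ContDiff ℝ (⊤ : ℕ∞) u) (hcs : HasCompactSupport u) :
    Integrable fun x => (‖x‖ ^ 2)⁻¹ * gradSq u x := by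
  have : Nontrivial (E n) := by
    have : Nonempty (Fin n) := ⟨⟨0, by omega⟩⟩
    infer_instance
  obtain ⟨R, hR⟩ := hcs.isCompact.isBounded.subset_ball (0 : E n)
  have hball : IntegrableOn (fun x : E n => (‖x‖ ^ 2)⁻¹) (Metric.ball 0 R) := by
    rw [integrableOn_fun_norm_addHaar (μ := volume) (f := fun t : ℝ => (t ^ 2)⁻¹)]
    have hp : IntegrableOn (fun t : ℝ => t ^ (n - 3)) (Ioo 0 R) :=
      ((continuous_pow (n - 3)).integrableOn_Icc (a := 0) (b := R)).mono_set Ioo_subset_Icc_self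
    refine hp.congr_fun (fun t ht => ?_) measurableSet_Ioo
    have : n - 1 = n - 3 + 2 := by omega
    simp only [finrank_euclideanSpace, Fintype.card_fin, smul_eq_mul, this, pow_add]
    rw [mul_assoc, mul_inv_cancel₀ (pow_ne_zero 2 ht.1.ne'), mul_one]
  have hNc := (contDiff_gradSq hu).continuous
  obtain ⟨K, hK⟩ := (HasCompactSupport.intro hcs fun x hx =>
    gradSq_of_notMem_tsupport (u := u) hx).exists_bound_of_continuous hNc
  have hi : IntegrableOn (fun x => (‖x‖ ^ 2)⁻¹ * gradSq u x) (Metric.ball 0 R) :=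
    Integrable.mul_bdd (c := K) hball hNc.aestronglyMeasurable (Eventually.of_forall hK)
  refine (integrableOn_iff_integrable_of_support_subset fun x hx => hR ?_).1 hi
  by_contra hx'
  exact hx (by simp [gradSq_of_notMem_tsupport hx'])

theorem stmt_0 (n : ℕ) (hn : 5 ≤ n) (Ω : Set (E n)) (hΩ : IsOpen Ω)
    (V H : ℝ → ℝ)
    (hV0 : ∀ t > (0:ℝ), 0 ≤ V t)
    (hVsm : ContDiffOn ℝ (⊤ : ℕ∞) V (Ioi 0)) (hHsm : ContDiffOn ℝ (⊤ : ℕ∞) H (Ioi 0))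
    (hRic : ∀ t > (0:ℝ), -(deriv H t) + H t * (((n : ℝ) - 1) / t) - (H t) ^ 2 ≥ V t)
    (hE1 : ∀ t > (0:ℝ), deriv H t + H t * (((n : ℝ) - 3) / t) ≥ 0)
    (u : E n → ℝ) (hu : ContDiff ℝ (⊤ : ℕ∞) u) (hcs : HasCompactSupport u)
    (hsupp : tsupport u ⊆ Ω) :
    ∫ x in Ω, (eLap u x) ^ 2 ≥ ∫ x in Ω, V ‖x‖ * (radDeriv 0 u x) ^ 2 := by
  have hm : (2 : ℝ) < n := by exact_mod_cast (by omega : 2 < n)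
  have hL : ∀ x ∉ Ω, eLap u x ^ 2 = 0 := fun x hx => by
    simp [eLap_of_notMem_tsupport (notMem_subset hsupp hx)]
  have hR : ∀ x ∉ Ω, V ‖x‖ * radDeriv 0 u x ^ 2 = 0 := fun x hx => by
    simp [radDeriv_zero_eq, eulerDeriv_of_notMem_tsupport (notMem_subset hsupp hx)]
  rw [ge_iff_le, setIntegral_eq_integral_of_forall_compl_eq_zero hL,
    setIntegral_eq_integral_of_forall_compl_eq_zero hR]
  have key (k : ℕ) := integral_truncated_le (φ := originCutoff k) hn hV0 hVsm.continuousOn hHsm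
    hRic hE1 hu hcs (contDiff_originCutoff k) (fun t => smoothTransition.nonneg _)
    (fun t => smoothTransition.le_one _) (deriv_originCutoff_nonneg k)
    (δ := 1 / ((k : ℝ) + 1)) (by positivity) (fun t ht => originCutoff_of_lt ht)
  obtain ⟨M, hM0, hM⟩ := exists_deriv_originCutoff_le
  have hlim := tendsto_integral_of_dominated_convergence
    (f := fun x => V ‖x‖ * radDeriv 0 u x ^ 2)
    (fun x : E n => ((2 * n - 4) ^ 2 + M * (2 * n - 4)) * ((‖x‖ ^ 2)⁻¹ * gradSq u x))
    (fun k => (key k).1.aestronglyMeasurable)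
    ((integrable_inv_norm_sq_mul_gradSq (by omega) hu hcs).const_mul _)
    (fun k => Eventually.of_forall fun x => ?_) (Eventually.of_forall fun x => ?_)
  · exact le_of_tendsto' hlim fun k => (key k).2
  · rcases eq_or_ne x 0 with rfl | hx
    · simp [eulerDeriv]
    have ht := norm_pos_iff.2 hx
    obtain ⟨hH0, hH1, hV1⟩ := riccati_bounds ht hm (hV0 _ ht) (hRic _ ht) (hE1 _ ht)
    have hφ0 : 0 ≤ originCutoff k ‖x‖ := smoothTransition.nonneg _
    have hφ1 : originCutoff k ‖x‖ ≤ 1 := smoothTransition.le_one _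
    have hd0 := deriv_originCutoff_nonneg k ‖x‖
    have hd1 : deriv (originCutoff k) ‖x‖ ≤ M / ‖x‖ := by
      rw [le_div_iff₀ ht, mul_comm]
      exact hM k _
    have h1 : originCutoff k ‖x‖ * V ‖x‖ ≤ ((2 * n - 4) / ‖x‖) ^ 2 :=
      (mul_le_of_le_one_left (hV0 _ ht) hφ1).trans hV1
    have h2 : deriv (originCutoff k) ‖x‖ * H ‖x‖ ≤ M / ‖x‖ * ((2 * n - 4) / ‖x‖) :=
      mul_le_mul hd1 hH1 hH0 (div_nonneg hM0 ht.le)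
    have habs : |originCutoff k ‖x‖ * V ‖x‖ - deriv (originCutoff k) ‖x‖ * H ‖x‖| ≤
        ((2 * n - 4) ^ 2 + M * (2 * n - 4)) / ‖x‖ ^ 2 := by
      have h3 := mul_nonneg hφ0 (hV0 _ ht)
      have h4 := mul_nonneg hd0 hH0
      have h5 : ((2 * n - 4) ^ 2 + M * (2 * n - 4)) / ‖x‖ ^ 2 =
        ((2 * n - 4) / ‖x‖) ^ 2 + M / ‖x‖ * ((2 * n - 4) / ‖x‖) := by field_simp
      rw [h5, abs_le]
      constructor <;> linarith
    rw [norm_eq_abs, abs_mul, abs_div, abs_of_nonneg (sq_nonneg (eulerDeriv u x)),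
      abs_of_nonneg (sq_nonneg ‖x‖)]
    calc _ ≤ ((2 * n - 4) ^ 2 + M * (2 * n - 4)) / ‖x‖ ^ 2 / ‖x‖ ^ 2 *
          (‖x‖ ^ 2 * gradSq u x) := by
            have := div_nonneg ((abs_nonneg _).trans habs) (sq_nonneg ‖x‖)
            gcongr
            exact eulerDeriv_sq_le u x
      _ = _ := by field_simp
  · rcases eq_or_ne x 0 with rfl | hx
    · simp [eulerDeriv, radDeriv]
    refine tendsto_const_nhds.congr' ?_
    filter_upwards [eventually_originCutoff (norm_pos_iff.2 hx)] with k hk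
    rw [hk.1, hk.2, radDeriv_zero_eq, div_pow]
    ring
end
end

section
/- Let n ≥ 5, Ω ⊆ ℝⁿ an open set, V : (0,∞) → [0,∞) and H : (0,∞) → ℝ smooth functions such that −H'(t) + H(t)·(n−1)/t − H(t)² ≥ V(t) for all t > 0. If E₂(t) = 2H'(t) + H(t)·(H(t) − 2/t) ≥ 0 for all t > 0, then for every u ∈ C_0^∞(Ω) one has ∫_Ω |Δu|² dx ≥ ∫_Ω V(|x|)·|∇u(x)|² dx. -/
open MeasureTheory Real Set Filter
open scoped RealInnerProductSpace ENNReal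

noncomputable section

open Topology

theorem integral_fderiv_apply_eq_zero_s1 {F : Type*} [NormedAddCommGroup F] [NormedSpace ℝ F]
    [FiniteDimensional ℝ F] [MeasurableSpace F] [BorelSpace F] (μ : Measure F)
    [μ.IsAddHaarMeasure] {g : F → ℝ}
    (hg : ContDiff ℝ 1 g) (hc : HasCompactSupport g) (v : F) :
    ∫ x, fderiv ℝ g x v ∂μ = 0 := by
  have hi : Integrable (fun x => fderiv ℝ g x v) μ :=
    ((hg.continuous_fderiv one_ne_zero).clm_apply continuous_const).integrable_of_hasCompactSupport
      (hc.fderiv_apply ℝ v)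
  have h := integral_mul_fderiv_eq_neg_fderiv_mul_of_integrable (μ := μ) (f := fun _ : F => (1 : ℝ))
    (g := g) (v := v) (by simp) (by simpa using hi)
    (by simpa using hg.continuous.integrable_of_hasCompactSupport hc)
    (fun x _ => by fun_prop) (fun x _ => hg.differentiable one_ne_zero x)
  simpa using h

theorem gradient_apply {n : ℕ} (u : E n → ℝ) (x : E n) (i : Fin n) :
    gradient u x i = fderiv ℝ u x (EuclideanSpace.single i 1) := by
  rw [← inner_gradient_left, EuclideanSpace.inner_single_right]
  simp

theorem clm_apply_eq_sum {n : ℕ} (L : E n →L[ℝ] ℝ) (v : E n) :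
    L v = ∑ i, v i * L (EuclideanSpace.single i 1) := by
  have h : v = ∑ i, v i • (EuclideanSpace.single i (1 : ℝ)) := by
    ext j
    simp [Finset.sum_apply, Pi.single_apply]
  conv_lhs => rw [h]
  simp [map_sum]

/-- The divergence of `h ⟨x, ∇u⟩ ∇u - ½ h |∇u|² x`. -/
def pohozaevDiv {n : ℕ} (u h : E n → ℝ) (x : E n) : ℝ :=
  fderiv ℝ h x (gradient u x) * ⟪gradient u x, x⟫ +
    h x * (⟪gradient u x, x⟫ * eLap u x + (1 - (n : ℝ) / 2) * ‖gradient u x‖ ^ 2) -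
    1 / 2 * fderiv ℝ h x x * ‖gradient u x‖ ^ 2

theorem integral_pohozaevDiv {n : ℕ} {u h : E n → ℝ} (hu : ContDiff ℝ 2 u)
    (hc : HasCompactSupport u) (hh : ContDiff ℝ 1 h) :
    Integrable (pohozaevDiv u h) ∧ ∫ x, pohozaevDiv u h x = 0 := by
  set e : Fin n → E n := fun i => EuclideanSpace.single i 1 with he
  set p : Fin n → E n → ℝ := fun i x => fderiv ℝ u x (e i) with hp
  have hpc : ∀ i, ContDiff ℝ 1 (p i) := fun i =>
    (hu.fderiv_right (m := 1) (by norm_num)).clm_apply contDiff_const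
  set F : Fin n → E n → ℝ := fun i x =>
    h x * ((∑ j, x j * p j x) * p i x - 1 / 2 * (∑ j, p j x * p j x) * x i) with hF
  have hcoord : ∀ j : Fin n, ContDiff ℝ 1 (fun x : E n => x j) := fun j =>
    (EuclideanSpace.proj (𝕜 := ℝ) j).contDiff
  have hFc : ∀ i, ContDiff ℝ 1 (F i) := by
    intro i
    have h1 : ContDiff ℝ 1 (fun x : E n => ∑ j, x j * p j x) :=
      ContDiff.sum fun j _ => (hcoord j).mul (hpc j)
    have h2 : ContDiff ℝ 1 (fun x : E n => ∑ j, p j x * p j x) :=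
      ContDiff.sum fun j _ => (hpc j).mul (hpc j)
    exact hh.mul ((h1.mul (hpc i)).sub ((contDiff_const.mul h2).mul (hcoord i)))
  have hFs : ∀ i, HasCompactSupport (F i) := by
    intro i
    refine (hc.fderiv (𝕜 := ℝ)).mono ?_
    intro x hx
    contrapose! hx
    have : fderiv ℝ u x = 0 := by simpa using hx
    simp [hF, hp, this]
  have hdiv : pohozaevDiv u h = fun x => ∑ i, fderiv ℝ (F i) x (e i) := by
    funext x
    have hsymm : ∀ i j, fderiv ℝ (p j) x (e i) = fderiv ℝ (p i) x (e j) := by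
      intro i j
      have hd : DifferentiableAt ℝ (fderiv ℝ u) x :=
        (hu.fderiv_right (m := 1) (by norm_num)).differentiable one_ne_zero x
      have hq : ∀ k, fderiv ℝ (p k) x = (fderiv ℝ (fderiv ℝ u) x).flip (e k) := by
        intro k
        have := (hd.hasFDerivAt.clm_apply (hasFDerivAt_const (e k) x)).fderiv
        simpa [hp] using this
      have hs : IsSymmSndFDerivAt ℝ u x :=
        hu.contDiffAt.isSymmSndFDerivAt (by simp)
      rw [hq, hq]
      exact hs (e i) (e j)
    have hder : ∀ i, fderiv ℝ (F i) x (e i) =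
        fderiv ℝ h x (e i) * ((∑ j, x j * p j x) * p i x - 1 / 2 * (∑ j, p j x * p j x) * x i) +
        h x * ((p i x + ∑ j, x j * fderiv ℝ (p j) x (e i)) * p i x
          + (∑ j, x j * p j x) * fderiv ℝ (p i) x (e i)
          - (∑ j, p j x * fderiv ℝ (p j) x (e i)) * x i
          - 1 / 2 * (∑ j, p j x * p j x)) := by
      intro i
      have hpd : ∀ j, HasFDerivAt (p j) (fderiv ℝ (p j) x) x := fun j =>
        ((hpc j).differentiable one_ne_zero x).hasFDerivAt
      have hcd : ∀ j : Fin n, HasFDerivAt (fun x : E n => x j) (EuclideanSpace.proj (𝕜 := ℝ) j) x :=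
        fun j => (EuclideanSpace.proj (𝕜 := ℝ) j).hasFDerivAt
      have h1 := HasFDerivAt.fun_sum (u := Finset.univ) fun j _ => (hcd j).fun_mul (hpd j)
      have h2 := HasFDerivAt.fun_sum (u := Finset.univ) fun j _ => (hpd j).fun_mul (hpd j)
      have h3 := ((hh.differentiable one_ne_zero x).hasFDerivAt).fun_mul
        ((h1.fun_mul (hpd i)).fun_sub ((h2.const_mul (1 / 2)).fun_mul (hcd i)))
      have h4 : fderiv ℝ (F i) x = _ := h3.fderiv
      rw [h4]
      have h5 : ∑ j, p j x * (e i) j = p i x := by simp [he]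
      have h6 : (e i) i = 1 := by simp [he]
      have h7 : ∀ j, EuclideanSpace.proj (𝕜 := ℝ) j (e i) = (e i) j := fun j => rfl
      simp only [add_apply, sub_apply, smul_apply, sum_apply, smul_eq_mul,
        h7, Finset.sum_add_distrib, h5, h6]
      ring
    have hin : ⟪gradient u x, x⟫ = ∑ j, x j * p j x := by
      rw [inner_gradient_left, clm_apply_eq_sum]
    have hnorm : ‖gradient u x‖ ^ 2 = ∑ j, p j x * p j x := by
      rw [EuclideanSpace.real_norm_sq_eq]
      simp [gradient_apply, hp, he, sq]
    have hlap : eLap u x = ∑ i, fderiv ℝ (p i) x (e i) := rfl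
    have hhg : fderiv ℝ h x (gradient u x) = ∑ i, p i x * fderiv ℝ h x (e i) := by
      rw [clm_apply_eq_sum]
      simp [gradient_apply, hp, he]
    have hhx : fderiv ℝ h x x = ∑ i, x i * fderiv ℝ h x (e i) := clm_apply_eq_sum _ _
    have hcross : ∑ i, (∑ j, x j * fderiv ℝ (p j) x (e i)) * p i x =
        ∑ i, (∑ j, p j x * fderiv ℝ (p j) x (e i)) * x i := by
      simp only [Finset.sum_mul]
      rw [Finset.sum_comm]
      refine Finset.sum_congr rfl fun i _ => Finset.sum_congr rfl fun j _ => ?_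
      rw [hsymm j i]
      ring
    simp only [pohozaevDiv, hder, hin, hnorm, hlap, hhg, hhx]
    set S := ∑ j, x j * p j x
    set Q := ∑ j, p j x * p j x with hQ
    have e1 : ∀ i, fderiv ℝ h x (e i) * (S * p i x - 1 / 2 * Q * x i) +
        h x * ((p i x + ∑ j, x j * fderiv ℝ (p j) x (e i)) * p i x
          + S * fderiv ℝ (p i) x (e i)
          - (∑ j, p j x * fderiv ℝ (p j) x (e i)) * x i - 1 / 2 * Q) =
        S * (p i x * fderiv ℝ h x (e i)) - 1 / 2 * Q * (x i * fderiv ℝ h x (e i)) +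
        h x * (p i x * p i x) + h x * ((∑ j, x j * fderiv ℝ (p j) x (e i)) * p i x) +
        h x * S * fderiv ℝ (p i) x (e i)
        - h x * ((∑ j, p j x * fderiv ℝ (p j) x (e i)) * x i) - h x * (1 / 2 * Q) := by
      intro i; ring
    simp only [e1, Finset.sum_add_distrib, Finset.sum_sub_distrib, ← Finset.mul_sum, hcross, ← hQ]
    simp
    ring
  have hint : ∀ i, Integrable (fun x => fderiv ℝ (F i) x (e i)) := fun i =>
    (((hFc i).continuous_fderiv one_ne_zero).clm_apply
      continuous_const).integrable_of_hasCompactSupport ((hFs i).fderiv_apply ℝ (e i))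
  rw [hdiv]
  refine ⟨integrable_finsetSum _ fun i _ => hint i, ?_⟩
  rw [integral_finsetSum _ fun i _ => hint i]
  exact Finset.sum_eq_zero fun i _ => integral_fderiv_apply_eq_zero_s1 _ (hFc i) (hFs i) (e i)

theorem exists_cutoff (n : ℕ) : ∃ K : ℝ, 0 ≤ K ∧ ∀ ε > (0 : ℝ), ∃ η : E n → ℝ,
    ContDiff ℝ 1 η ∧ (∀ x, 0 ≤ η x) ∧ (∀ x, η x ≤ 1) ∧
    (∀ x, ‖x‖ < ε → η =ᶠ[𝓝 x] 0) ∧ (∀ x, 2 * ε < ‖x‖ → η =ᶠ[𝓝 x] 1) ∧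
    ∀ x, ‖fderiv ℝ η x‖ ≤ K / ε := by
  let b : ContDiffBump (0 : E n) := ⟨1, 2, one_pos, one_lt_two⟩
  have hb : ContDiff ℝ 1 (b : E n → ℝ) := b.contDiff
  obtain ⟨K, hK⟩ := (b.hasCompactSupport.fderiv (𝕜 := ℝ)).exists_bound_of_continuous
    (hb.continuous_fderiv one_ne_zero)
  have hK0 : 0 ≤ K := (norm_nonneg _).trans (hK 0)
  refine ⟨K, hK0, fun ε hε => ⟨fun x => 1 - b (ε⁻¹ • x), ?_, ?_, ?_, ?_, ?_, ?_⟩⟩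
  · exact contDiff_const.sub (hb.comp (contDiff_const_smul _))
  · intro x; linarith [b.le_one (x := ε⁻¹ • x)]
  · intro x; linarith [b.nonneg (x := ε⁻¹ • x)]
  · intro x hx
    have : ∀ᶠ y in 𝓝 x, ‖y‖ < ε := continuous_norm.continuousAt.eventually_lt_const hx
    filter_upwards [this] with y hy
    have : b (ε⁻¹ • y) = 1 := b.one_of_mem_closedBall (by
      rw [mem_closedBall_zero_iff, norm_smul, norm_inv, Real.norm_of_nonneg hε.le,
        inv_mul_le_iff₀ hε]
      simpa [b] using hy.le)
    simp [this]
  · intro x hx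
    have : ∀ᶠ y in 𝓝 x, 2 * ε < ‖y‖ := continuous_norm.continuousAt.eventually_const_lt hx
    filter_upwards [this] with y hy
    have : b (ε⁻¹ • y) = 0 := b.zero_of_le_dist (by
      rw [dist_zero_right, norm_smul, norm_inv, Real.norm_of_nonneg hε.le,
        le_inv_mul_iff₀ hε]
      simpa [b, mul_comm] using hy.le)
    simp [this]
  · intro x
    have h1 : HasFDerivAt (fun x => 1 - b (ε⁻¹ • x))
        (-((fderiv ℝ b (ε⁻¹ • x)).comp (ε⁻¹ • ContinuousLinearMap.id ℝ (E n)))) x := by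
      have h2 : HasFDerivAt (fun x : E n => ε⁻¹ • x) (ε⁻¹ • ContinuousLinearMap.id ℝ (E n)) x :=
        (hasFDerivAt_id x).const_smul ε⁻¹
      have h3 : HasFDerivAt b (fderiv ℝ b (ε⁻¹ • x)) (ε⁻¹ • x) :=
        (hb.differentiable one_ne_zero _).hasFDerivAt
      exact (HasFDerivAt.comp x h3 h2).const_sub 1
    rw [h1.fderiv, norm_neg, ContinuousLinearMap.comp_smul, ContinuousLinearMap.comp_id,
      norm_smul, norm_inv, Real.norm_of_nonneg hε.le, div_eq_inv_mul]
    exact mul_le_mul_of_nonneg_left (hK _) (by positivity)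

theorem hasFDerivAt_norm_of_ne_zero {F : Type*} [NormedAddCommGroup F] [InnerProductSpace ℝ F]
    {x : F} (hx : x ≠ 0) : HasFDerivAt (fun y : F => ‖y‖) (‖x‖⁻¹ • innerSL ℝ x) x := by
  have h := (hasStrictFDerivAt_norm_sq x).hasFDerivAt.sqrt (by simpa using hx)
  simp only [Real.sqrt_sq (norm_nonneg _)] at h
  convert h using 1
  ext v
  simp
  field_simp

/-- The radial multiplier `H(|x|) / |x|`. -/
def radialMultiplier {n : ℕ} (H : ℝ → ℝ) (x : E n) : ℝ := H ‖x‖ / ‖x‖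

theorem contDiffAt_radialMultiplier {n : ℕ} {H : ℝ → ℝ} (hH : ContDiffOn ℝ 1 H (Ioi 0))
    {x : E n} (hx : x ≠ 0) : ContDiffAt ℝ 1 (radialMultiplier H) x := by
  have hx' : 0 < ‖x‖ := norm_pos_iff.2 hx
  have hn : ContDiffAt ℝ 1 (fun y : E n => ‖y‖) x := contDiffAt_norm ℝ hx
  have h1 : ContDiffAt ℝ 1 H ‖x‖ := hH.contDiffAt (Ioi_mem_nhds hx')
  exact (h1.comp x hn).div hn hx'.ne'

theorem fderiv_radialMultiplier_apply {n : ℕ} {H : ℝ → ℝ} {x : E n} (hx : x ≠ 0)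
    (hH : DifferentiableAt ℝ H ‖x‖) (v : E n) :
    fderiv ℝ (radialMultiplier H) x v =
      (deriv H ‖x‖ * ‖x‖ - H ‖x‖) / ‖x‖ ^ 3 * ⟪v, x⟫ := by
  have hx' : ‖x‖ ≠ 0 := norm_ne_zero_iff.2 hx
  have h1 : HasDerivAt (fun t => H t / t) ((deriv H ‖x‖ * ‖x‖ - H ‖x‖ * 1) / ‖x‖ ^ 2) ‖x‖ :=
    hH.hasDerivAt.div (hasDerivAt_id _) hx'
  have h2 : fderiv ℝ (radialMultiplier H) x = _ :=
    (h1.comp_hasFDerivAt x (hasFDerivAt_norm_of_ne_zero hx)).fderiv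
  rw [h2]
  simp [real_inner_comm]
  field_simp

theorem radial_rellich_pointwise {n : ℕ} {V H : ℝ → ℝ} {u : E n → ℝ} {x : E n} (hx : x ≠ 0)
    (hH : DifferentiableAt ℝ H ‖x‖)
    (hRic : -(deriv H ‖x‖) + H ‖x‖ * (((n : ℝ) - 1) / ‖x‖) - (H ‖x‖) ^ 2 ≥ V ‖x‖)
    (hE2 : 2 * deriv H ‖x‖ + H ‖x‖ * (H ‖x‖ - 2 / ‖x‖) ≥ 0) :
    V ‖x‖ * ‖gradient u x‖ ^ 2 + 2 * pohozaevDiv u (radialMultiplier H) x ≤ (eLap u x) ^ 2 := by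
  have ht : 0 < ‖x‖ := norm_pos_iff.2 hx
  simp only [pohozaevDiv, fderiv_radialMultiplier_apply hx hH, radialMultiplier,
    real_inner_self_eq_norm_sq]
  have hcs : ⟪gradient u x, x⟫ ^ 2 ≤ ‖gradient u x‖ ^ 2 * ‖x‖ ^ 2 := by
    rw [← mul_pow]
    exact sq_le_sq' (by linarith [neg_le_of_abs_le (abs_real_inner_le_norm (gradient u x) x)])
      (real_inner_le_norm _ _)
  generalize ⟪gradient u x, x⟫ = s at *
  generalize ‖gradient u x‖ ^ 2 = N at *
  generalize eLap u x = L
  generalize deriv H ‖x‖ = H' at *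
  generalize H ‖x‖ = a at *
  generalize V ‖x‖ = b at *
  generalize ‖x‖ = t at *
  have hr : (s / t) ^ 2 ≤ N := by
    rw [div_pow, div_le_iff₀ (by positivity)]
    exact hcs
  have hN : 0 ≤ N := (sq_nonneg _).trans hr
  have h1 := mul_le_mul_of_nonneg_right hRic hN
  have h2 := mul_le_mul_of_nonneg_left hr hE2
  have h3 := sq_nonneg (L - a * (s / t))
  have e : 2 * ((H' * t - a) / t ^ 3 * s * s + a / t * (s * L + (1 - (n : ℝ) / 2) * N) -
      1 / 2 * ((H' * t - a) / t ^ 3 * t ^ 2) * N) =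
      2 * (H' - a / t) * (s / t) ^ 2 + 2 * a * (s / t) * L + (2 - n) * (a / t) * N
        - (H' - a / t) * N := by
    field_simp
    ring
  rw [e]
  have e2 : a * (((n : ℝ) - 1) / t) = (n - 1) * (a / t) := by ring
  have e3 : 2 * H' + a * (a - 2 / t) = 2 * H' + a ^ 2 - 2 * (a / t) := by ring
  rw [e2] at h1
  rw [e3] at h2
  nlinarith

theorem riccati_bounds_s1 {n : ℕ} (hn : 3 ≤ n) {a a' b t : ℝ} (ht : 0 < t) (hb : 0 ≤ b)
    (hRic : -a' + a * (((n : ℝ) - 1) / t) - a ^ 2 ≥ b)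
    (hE2 : 2 * a' + a * (a - 2 / t) ≥ 0) : |a| ≤ 2 * n / t := by
  have h1 : a ^ 2 / 2 ≤ (n - 2) * (a / t) := by
    have e1 : a * (((n : ℝ) - 1) / t) = (n - 1) * (a / t) := by ring
    have e2 : a * (a - 2 / t) = a ^ 2 - 2 * (a / t) := by ring
    rw [e1] at hRic
    rw [e2] at hE2
    linarith
  have hn' : (3 : ℝ) ≤ n := by exact_mod_cast hn
  have h2 : 0 ≤ a / t := by
    by_contra! h
    nlinarith [sq_nonneg a]
  have h3 : 0 ≤ a := by
    by_contra! h
    exact absurd (div_neg_of_neg_of_pos h ht) (not_lt.2 h2)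
  rw [abs_of_nonneg h3, le_div_iff₀ ht]
  have h4 : a ^ 2 * t ≤ 2 * (n - 2) * a := by
    have := mul_le_mul_of_nonneg_right h1 ht.le
    have e : (n - 2) * (a / t) * t = (n - 2) * a := by field_simp
    linarith
  rcases h3.eq_or_lt with h | h
  · rw [← h]; simp
  · nlinarith

theorem pohozaevDiv_mul {n : ℕ} {u η h : E n → ℝ} {x : E n} (hη : DifferentiableAt ℝ η x)
    (hh : DifferentiableAt ℝ h x) :
    pohozaevDiv u (fun y => η y * h y) x = η x * pohozaevDiv u h x +
      h x * (fderiv ℝ η x (gradient u x) * ⟪gradient u x, x⟫ -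
        1 / 2 * fderiv ℝ η x x * ‖gradient u x‖ ^ 2) := by
  simp only [pohozaevDiv, fderiv_fun_mul hη hh, add_apply, smul_apply, smul_eq_mul]
  ring

theorem abs_cutoff_error_le {n : ℕ} (L : E n →L[ℝ] ℝ) (w x : E n) {k M : ℝ}
    (hL : ‖L‖ ≤ k) (hw : ‖w‖ ≤ M) :
    |L w * ⟪w, x⟫ - 1 / 2 * L x * ‖w‖ ^ 2| ≤ 2 * k * M ^ 2 * ‖x‖ := by
  have hk : 0 ≤ k := (norm_nonneg _).trans hL
  have h1 : |L w| ≤ k * ‖w‖ := L.le_of_opNorm_le hL w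
  have h2 : |L x| ≤ k * ‖x‖ := L.le_of_opNorm_le hL x
  have h3 : |⟪w, x⟫| ≤ ‖w‖ * ‖x‖ := abs_real_inner_le_norm w x
  have h4 : |L w * ⟪w, x⟫| ≤ k * ‖x‖ * ‖w‖ ^ 2 := by
    rw [abs_mul]
    calc _ ≤ (k * ‖w‖) * (‖w‖ * ‖x‖) := by gcongr
      _ = _ := by ring
  have h5 : |1 / 2 * L x * ‖w‖ ^ 2| ≤ k * ‖x‖ * ‖w‖ ^ 2 := by
    rw [abs_mul, abs_mul, abs_of_nonneg (sq_nonneg ‖w‖), abs_of_pos one_half_pos]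
    exact mul_le_mul_of_nonneg_right (by linarith [abs_nonneg (L x)]) (sq_nonneg _)
  have h6 : k * ‖x‖ * ‖w‖ ^ 2 ≤ k * ‖x‖ * M ^ 2 := by gcongr
  calc _ ≤ |L w * ⟪w, x⟫| + |1 / 2 * L x * ‖w‖ ^ 2| := abs_sub _ _
    _ ≤ _ := by linarith

theorem eLap_continuous {n : ℕ} {u : E n → ℝ} (hu : ContDiff ℝ 2 u) : Continuous (eLap u) := by
  refine continuous_finsetSum _ fun i _ => ?_
  have h : ContDiff ℝ 1 (fun y => fderiv ℝ u y (EuclideanSpace.single i 1)) :=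
    (hu.fderiv_right (m := 1) (by norm_num)).clm_apply contDiff_const
  exact (h.continuous_fderiv one_ne_zero).clm_apply continuous_const

theorem eLap_eq_zero_of_notMem_tsupport {n : ℕ} {u : E n → ℝ} {x : E n} (hx : x ∉ tsupport u) :
    eLap u x = 0 := by
  have h1 : ∀ᶠ y in 𝓝 x, y ∉ tsupport u := (isClosed_tsupport u).isOpen_compl.mem_nhds hx
  refine Finset.sum_eq_zero fun i _ => ?_
  have h2 : (fun y => fderiv ℝ u y (EuclideanSpace.single i 1)) =ᶠ[𝓝 x] fun _ => 0 := by
    filter_upwards [h1] with y hy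
    rw [fderiv_of_notMem_tsupport ℝ hy]
    simp
  rw [h2.fderiv_eq]
  simp

theorem gradient_eq_zero_of_notMem_tsupport {n : ℕ} {u : E n → ℝ} {x : E n}
    (hx : x ∉ tsupport u) : gradient u x = 0 := by
  simp [gradient, fderiv_of_notMem_tsupport ℝ hx]

theorem integral_cutoff_le {n : ℕ} (hn : 3 ≤ n) {V H : ℝ → ℝ}
    (hV0 : ∀ t > (0:ℝ), 0 ≤ V t) (hHsm : ContDiffOn ℝ 1 H (Ioi 0))
    (hRic : ∀ t > (0:ℝ), -(deriv H t) + H t * (((n : ℝ) - 1) / t) - (H t) ^ 2 ≥ V t)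
    (hE2 : ∀ t > (0:ℝ), 2 * deriv H t + H t * (H t - 2 / t) ≥ 0)
    {u : E n → ℝ} (hu : ContDiff ℝ 2 u) (hcs : HasCompactSupport u)
    (hint : Integrable (fun x : E n => V ‖x‖ * ‖gradient u x‖ ^ 2))
    {M : ℝ} (hM : ∀ x, ‖gradient u x‖ ≤ M) {K ε : ℝ} (hK : 0 ≤ K) (hε : 0 < ε) {η : E n → ℝ}
    (hη : ContDiff ℝ 1 η) (hη0 : ∀ x, 0 ≤ η x) (hη1 : ∀ x, η x ≤ 1)
    (hηin : ∀ x, ‖x‖ < ε → η =ᶠ[𝓝 x] 0) (hηout : ∀ x, 2 * ε < ‖x‖ → η =ᶠ[𝓝 x] 1)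
    (hηd : ∀ x, ‖fderiv ℝ η x‖ ≤ K / ε) :
    ∫ x, η x * (V ‖x‖ * ‖gradient u x‖ ^ 2) ≤ (∫ x, (eLap u x) ^ 2) +
      8 * n * K * M ^ 2 / ε ^ 2 * volume.real (Metric.closedBall (0 : E n) (2 * ε)) := by
  set g : E n → ℝ := fun x => η x * radialMultiplier H x with hg
  have hgin : ∀ x, ‖x‖ < ε → g =ᶠ[𝓝 x] fun _ => 0 := by
    intro x hx
    filter_upwards [hηin x hx] with y hy
    simp [hg, hy]
  have hgc : ContDiff ℝ 1 g := by
    rw [contDiff_iff_contDiffAt]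
    intro x
    by_cases hx : x = 0
    · exact contDiffAt_const.congr_of_eventuallyEq (hgin x (by simpa [hx] using hε))
    · exact hη.contDiffAt.mul (contDiffAt_radialMultiplier hHsm hx)
  obtain ⟨hDi, hD0⟩ := integral_pohozaevDiv hu hcs hgc
  set B : ℝ := 8 * n * K * M ^ 2 / ε ^ 2 with hB
  have hB0 : 0 ≤ B := by positivity
  set s : Set (E n) := Metric.closedBall (0 : E n) (2 * ε) with hs
  have hpt : ∀ x, η x * (V ‖x‖ * ‖gradient u x‖ ^ 2) ≤
      (eLap u x) ^ 2 - 2 * pohozaevDiv u g x + s.indicator (fun _ => B) x := by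
    intro x
    have hind : 0 ≤ s.indicator (fun _ => B) x := indicator_nonneg (fun _ _ => hB0) x
    rcases lt_or_ge ‖x‖ ε with hxε | hxε
    · have h1 : η x = 0 := (hηin x hxε).eq_of_nhds
      have h2 : pohozaevDiv u g x = 0 := by
        simp [pohozaevDiv, (hgin x hxε).fderiv_eq, (hgin x hxε).eq_of_nhds]
      rw [h1, h2]
      nlinarith [sq_nonneg (eLap u x)]
    · have ht : 0 < ‖x‖ := hε.trans_le hxε
      have hx : x ≠ 0 := norm_pos_iff.1 ht
      have hHd : DifferentiableAt ℝ H ‖x‖ :=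
        (hHsm.contDiffAt (Ioi_mem_nhds ht)).differentiableAt one_ne_zero
      have h1 := radial_rellich_pointwise (u := u) hx hHd (hRic _ ht) (hE2 _ ht)
      have h2 := pohozaevDiv_mul (u := u) (hη.differentiable one_ne_zero x)
        ((contDiffAt_radialMultiplier hHsm hx).differentiableAt one_ne_zero)
      have h3 : 2 * (radialMultiplier H x * (fderiv ℝ η x (gradient u x) * ⟪gradient u x, x⟫ -
          1 / 2 * fderiv ℝ η x x * ‖gradient u x‖ ^ 2)) ≤ s.indicator (fun _ => B) x := by
        by_cases hxs : x ∈ s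
        · rw [indicator_of_mem hxs]
          have h4 := abs_cutoff_error_le (fderiv ℝ η x) (gradient u x) x (hηd x) (hM x)
          have h5 : |radialMultiplier H x| ≤ 2 * n / ‖x‖ / ‖x‖ := by
            rw [radialMultiplier, abs_div, abs_norm]
            gcongr
            exact riccati_bounds_s1 hn ht (hV0 _ ht) (hRic _ ht) (hE2 _ ht)
          have h6 := mul_le_mul h5 h4 (abs_nonneg _) (by positivity)
          rw [← abs_mul] at h6
          have h7 : 2 * n / ‖x‖ / ‖x‖ * (2 * (K / ε) * M ^ 2 * ‖x‖) ≤ B / 2 := by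
            have e1 : 2 * n / ‖x‖ / ‖x‖ * (2 * (K / ε) * M ^ 2 * ‖x‖) =
                4 * n * K * M ^ 2 / (ε * ‖x‖) := by
              field_simp
              ring
            have e2 : B / 2 = 4 * n * K * M ^ 2 / (ε * ε) := by
              rw [hB]; field_simp; ring
            rw [e1, e2]
            gcongr
          linarith [le_of_abs_le (h6.trans h7)]
        · rw [indicator_of_notMem hxs]
          have h4 : fderiv ℝ η x = 0 := by
            rw [(hηout x (by simpa [hs] using hxs)).fderiv_eq]
            simp
          simp [h4]
      have h8 := mul_le_mul_of_nonneg_left h1 (hη0 x)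
      have h9 := mul_le_mul_of_nonneg_right (hη1 x) (sq_nonneg (eLap u x))
      rw [mul_add, mul_left_comm (η x) 2] at h8
      rw [show pohozaevDiv u g x = _ from h2]
      linarith
  have hLi : Integrable (fun x => (eLap u x) ^ 2) := by
    refine ((eLap_continuous hu).pow 2).integrable_of_hasCompactSupport
      (HasCompactSupport.intro hcs.isCompact fun x hx => ?_)
    simp [eLap_eq_zero_of_notMem_tsupport hx]
  have hsi : Integrable (s.indicator fun _ => B) :=
    (integrable_indicator_iff Metric.isClosed_closedBall.measurableSet).2
      (integrableOn_const Metric.isBounded_closedBall.measure_lt_top.ne)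
  have hηi : Integrable (fun x => η x * (V ‖x‖ * ‖gradient u x‖ ^ 2)) :=
    hint.bdd_mul hη.continuous.aestronglyMeasurable (c := 1)
      (ae_of_all _ fun x => by rw [Real.norm_of_nonneg (hη0 x)]; exact hη1 x)
  have h := integral_mono hηi ((hLi.sub (hDi.const_mul 2)).add hsi) hpt
  refine h.trans (le_of_eq ?_)
  have e1 := integral_add (hLi.sub (hDi.const_mul 2)) hsi
  have e2 := integral_sub hLi (hDi.const_mul 2)
  simp only [Pi.add_apply, Pi.sub_apply] at e1 e2 ⊢
  rw [e1, e2, integral_const_mul, hD0, integral_indicator Metric.isClosed_closedBall.measurableSet,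
    setIntegral_const]
  simp [hs, mul_comm]

theorem stmt_1 (n : ℕ) (hn : 5 ≤ n) (Ω : Set (E n)) (hΩ : IsOpen Ω)
    (V H : ℝ → ℝ)
    (hV0 : ∀ t > (0:ℝ), 0 ≤ V t)
    (hVsm : ContDiffOn ℝ (⊤ : ℕ∞) V (Ioi 0)) (hHsm : ContDiffOn ℝ (⊤ : ℕ∞) H (Ioi 0))
    (hRic : ∀ t > (0:ℝ), -(deriv H t) + H t * (((n : ℝ) - 1) / t) - (H t) ^ 2 ≥ V t)
    (hE2 : ∀ t > (0:ℝ), 2 * deriv H t + H t * (H t - 2 / t) ≥ 0)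
    (u : E n → ℝ) (hu : ContDiff ℝ (⊤ : ℕ∞) u) (hcs : HasCompactSupport u)
    (hsupp : tsupport u ⊆ Ω) :
    ∫ x in Ω, (eLap u x) ^ 2 ≥ ∫ x in Ω, V ‖x‖ * ‖gradient u x‖ ^ 2 := by
  have hu2 : ContDiff ℝ 2 u := hu.of_le (WithTop.coe_le_coe.2 (le_top : (2 : ℕ∞) ≤ ⊤))
  rw [setIntegral_eq_integral_of_forall_compl_eq_zero fun x hx => by
      simp [eLap_eq_zero_of_notMem_tsupport fun h => hx (hsupp h)],
    setIntegral_eq_integral_of_forall_compl_eq_zero fun x hx => by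
      simp [gradient_eq_zero_of_notMem_tsupport fun h => hx (hsupp h)]]
  by_cases hint : Integrable (fun x : E n => V ‖x‖ * ‖gradient u x‖ ^ 2)
  swap
  · rw [integral_undef hint]
    exact integral_nonneg fun x => sq_nonneg _
  obtain ⟨M, hM⟩ := (hcs.fderiv (𝕜 := ℝ)).exists_bound_of_continuous
    (hu2.continuous_fderiv two_ne_zero)
  have hM' : ∀ x, ‖gradient u x‖ ≤ M := fun x => by simpa [gradient] using hM x
  obtain ⟨K, hK, hcut⟩ := exists_cutoff n
  have hε : ∀ m : ℕ, (0 : ℝ) < 1 / ((m : ℝ) + 1) := fun m => Nat.one_div_pos_of_nat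
  choose η hη hη0 hη1 hηin hηout hηd using fun m : ℕ => hcut _ (hε m)
  have hle := fun m : ℕ => integral_cutoff_le (by lia) hV0 (hHsm.of_le (by exact_mod_cast le_top))
    hRic hE2 hu2 hcs hint hM' hK (hε m) (hη m) (hη0 m) (hη1 m) (hηin m) (hηout m) (hηd m)
  have hlim : Tendsto (fun m : ℕ => ∫ x, η m x * (V ‖x‖ * ‖gradient u x‖ ^ 2)) atTop
      (𝓝 (∫ x : E n, V ‖x‖ * ‖gradient u x‖ ^ 2)) := by
    refine tendsto_integral_of_dominated_convergence (fun x => ‖V ‖x‖ * ‖gradient u x‖ ^ 2‖)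
      (fun m => (hη m).continuous.aestronglyMeasurable.mul hint.aestronglyMeasurable) hint.norm
      (fun m => ae_of_all _ fun x => ?_) ?_
    · rw [norm_mul, Real.norm_of_nonneg (hη0 m x)]
      exact mul_le_of_le_one_left (norm_nonneg _) (hη1 m x)
    · have : Nonempty (Fin n) := ⟨⟨0, by lia⟩⟩
      filter_upwards [Measure.ae_ne volume (0 : E n)] with x hx
      refine tendsto_const_nhds.congr' ?_
      have h1 : Tendsto (fun m : ℕ => 2 * (1 / ((m : ℝ) + 1))) atTop (𝓝 (2 * 0)) :=
        tendsto_one_div_add_atTop_nhds_zero_nat.const_mul 2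
      filter_upwards [h1.eventually_lt_const (by simpa using hx : 2 * 0 < ‖x‖)] with m hm
      simp [(hηout m x hm).eq_of_nhds]
  have hlim2 : Tendsto (fun m : ℕ => (∫ x, (eLap u x) ^ 2) + 8 * n * K * M ^ 2 /
      (1 / ((m : ℝ) + 1)) ^ 2 * volume.real (Metric.closedBall (0 : E n) (2 * (1 / ((m : ℝ) + 1)))))
      atTop (𝓝 (∫ x : E n, (eLap u x) ^ 2)) := by
    set c := 8 * n * K * M ^ 2 * 2 ^ n * volume.real (Metric.ball (0 : E n) 1)
    have h1 : Tendsto (fun m : ℕ => (∫ x : E n, (eLap u x) ^ 2) +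
        c * (1 / ((m : ℝ) + 1)) ^ (n - 2)) atTop
        (𝓝 ((∫ x : E n, (eLap u x) ^ 2) + c * 0 ^ (n - 2))) :=
      ((tendsto_one_div_add_atTop_nhds_zero_nat.pow (n - 2)).const_mul c).const_add _
    rw [zero_pow (by lia), mul_zero, add_zero] at h1
    refine h1.congr fun m => ?_
    rw [Measure.addHaar_real_closedBall _ _ (by have := hε m; positivity)]
    have h2 := hε m
    generalize 1 / ((m : ℝ) + 1) = ε at h2
    have h3 : ε ^ n = ε ^ (n - 2) * ε ^ 2 := by rw [← pow_add]; congr 1; lia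
    rw [finrank_euclideanSpace_fin, mul_pow, h3]
    simp only [c]
    field_simp
  exact le_of_tendsto_of_tendsto' hlim hlim2 hle
end
end
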